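/- Suppose w ∈ S_n avoids the pattern 3412 and contains exactly one occurrence of the pattern 321 (that is, there is exactly one triple of indices i < j < k with w(i) > w(j) > w(k)). Let ℓ = ℓ(w). Then the principal Bruhat order ideal B(w) has cardinality |B(w)| = 3·2^{ℓ−2}. -/

import Mathlib

namespace Paper

/-! ### Type A: the symmetric group `S_n` as `Equiv.Perm (Fin n)` -/

/-- The simple transposition `s_i ∈ S_n` (1-indexed letter `i`, meaningful for
`1 ≤ i ≤ n-1`): it interchanges the entries in (1-indexed) positions `i` and `i+1`,
i.e. (0-indexed) positions `i-1` and `i` of `Fin n`. Out-of-range letters give `1`. -/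
def sA (n : ℕ) (i : ℕ) : Equiv.Perm (Fin n) :=
  if h : 1 ≤ i ∧ i < n then Equiv.swap ⟨i - 1, by omega⟩ ⟨i, h.2⟩ else 1

/-- The product `s_{i_1} ⋯ s_{i_ℓ}` of a word `i_1 ⋯ i_ℓ`. -/
def prodA (n : ℕ) (w : List ℕ) : Equiv.Perm (Fin n) := (w.map (sA n)).prod

/-- A word in the letters `{1, …, n-1}`. -/
def IsWordA (n : ℕ) (w : List ℕ) : Prop := ∀ i ∈ w, 1 ≤ i ∧ i ≤ n - 1

/-- `w` is a reduced decomposition of `x ∈ S_n`. -/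
def ReducedA (n : ℕ) (w : List ℕ) (x : Equiv.Perm (Fin n)) : Prop :=
  IsWordA n w ∧ prodA n w = x ∧
    ∀ w' : List ℕ, IsWordA n w' → prodA n w' = x → w.length ≤ w'.length

/-- The Coxeter length `ℓ(x)`: minimal length of a word for `x`. -/
noncomputable def lenA (n : ℕ) (x : Equiv.Perm (Fin n)) : ℕ :=
  sInf {l | ∃ w : List ℕ, IsWordA n w ∧ prodA n w = x ∧ w.length = l}

/-- Bruhat order on `S_n`: `v ≤ w` iff some reduced decomposition of `v` is a
(not necessarily consecutive) subword of some reduced decomposition of `w`. -/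
def bruhatA (n : ℕ) (v w : Equiv.Perm (Fin n)) : Prop :=
  ∃ a b : List ℕ, ReducedA n a v ∧ ReducedA n b w ∧ a.Sublist b

/-- `w ∈ S_n` is boolean: the principal order ideal `B(w)`, ordered by the Bruhat
order, is order-isomorphic to the lattice of all subsets of `{1,…,r}` for some `r`. -/
def BooleanA (n : ℕ) (w : Equiv.Perm (Fin n)) : Prop :=
  ∃ (r : ℕ) (e : {v : Equiv.Perm (Fin n) // bruhatA n v w} ≃ Finset (Fin r)),
    ∀ a b : {v : Equiv.Perm (Fin n) // bruhatA n v w}, bruhatA n a.1 b.1 ↔ e a ⊆ e b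

/-- Pattern containment: `w ∈ S_n` contains `p ∈ S_k`. -/
def ContainsA {n k : ℕ} (w : Equiv.Perm (Fin n)) (p : Equiv.Perm (Fin k)) : Prop :=
  ∃ f : Fin k → Fin n, StrictMono f ∧ ∀ a b : Fin k, w (f a) < w (f b) ↔ p a < p b

/-- Pattern avoidance. -/
def AvoidsA {n k : ℕ} (w : Equiv.Perm (Fin n)) (p : Equiv.Perm (Fin k)) : Prop :=
  ¬ ContainsA w p

/-- The pattern `321` (one-line notation). -/
def p321 : Equiv.Perm (Fin 3) := ⟨![2,1,0], ![2,1,0], by decide, by decide⟩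
/-- The pattern `231` (one-line notation). -/
def p231 : Equiv.Perm (Fin 3) := ⟨![1,2,0], ![2,0,1], by decide, by decide⟩
/-- The pattern `312` (one-line notation). -/
def p312 : Equiv.Perm (Fin 3) := ⟨![2,0,1], ![1,2,0], by decide, by decide⟩
/-- The pattern `3412` (one-line notation). -/
def p3412 : Equiv.Perm (Fin 4) := ⟨![2,3,0,1], ![2,3,0,1], by decide, by decide⟩

/-- The longest (decreasing) permutation `w_0^{(k)} = k (k-1) ⋯ 2 1 ∈ S_k`. -/
def w0 (k : ℕ) : Equiv.Perm (Fin k) := Fin.revPerm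

/-- The shift of a word by `M`: each letter `i` becomes `i + M`. -/
def shift (M : ℕ) (w : List ℕ) : List ℕ := w.map (· + M)




/-! ### Types B and D: signed permutations, modelled as permutations `w` of `ℤ`
with `w(-x) = -w(x)` that fix all integers of absolute value `> n`. -/

/-- The simple generators of `S_n^B`, as permutations of `ℤ`:
`sB 0` negates the value `1`; for `i ≥ 1`, `sB i` interchanges the values
`i` and `i+1` (and `-i` and `-(i+1)`). -/
def sB : ℕ → Equiv.Perm ℤ
  | 0 => Equiv.swap 1 (-1)
  | (i+1) => Equiv.swap ((i : ℤ) + 1) ((i : ℤ) + 2) * Equiv.swap (-((i : ℤ) + 1)) (-((i : ℤ) + 2))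

/-- The simple generators of `S_n^D`: letter `0` encodes `s_{1'} = s_0 s_1 s_0`
(mapping `1 ↦ -2` and `2 ↦ -1`), and letters `i ≥ 1` are as in type `B`. -/
def sD : ℕ → Equiv.Perm ℤ
  | 0 => sB 0 * sB 1 * sB 0
  | (i+1) => sB (i+1)

def prodB (w : List ℕ) : Equiv.Perm ℤ := (w.map sB).prod
def prodD (w : List ℕ) : Equiv.Perm ℤ := (w.map sD).prod

/-- A word in the type `B`/`D` letters `{0, 1, …, n-1}`. -/
def IsWordBD (n : ℕ) (w : List ℕ) : Prop := ∀ i ∈ w, i ≤ n - 1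

/-- `w` is a reduced decomposition of `x ∈ S_n^B`. -/
def ReducedB (n : ℕ) (w : List ℕ) (x : Equiv.Perm ℤ) : Prop :=
  IsWordBD n w ∧ prodB w = x ∧
    ∀ w' : List ℕ, IsWordBD n w' → prodB w' = x → w.length ≤ w'.length

/-- `w` is a reduced decomposition of `x ∈ S_n^D`. -/
def ReducedD (n : ℕ) (w : List ℕ) (x : Equiv.Perm ℤ) : Prop :=
  IsWordBD n w ∧ prodD w = x ∧
    ∀ w' : List ℕ, IsWordBD n w' → prodD w' = x → w.length ≤ w'.length

/-- Length in `S_n^B`. -/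
noncomputable def lenB (n : ℕ) (x : Equiv.Perm ℤ) : ℕ :=
  sInf {l | ∃ w : List ℕ, IsWordBD n w ∧ prodB w = x ∧ w.length = l}

/-- Length in `S_n^D`. -/
noncomputable def lenD (n : ℕ) (x : Equiv.Perm ℤ) : ℕ :=
  sInf {l | ∃ w : List ℕ, IsWordBD n w ∧ prodD w = x ∧ w.length = l}

/-- Bruhat order on `S_n^B`. -/
def bruhatB (n : ℕ) (v w : Equiv.Perm ℤ) : Prop :=
  ∃ a b : List ℕ, ReducedB n a v ∧ ReducedB n b w ∧ a.Sublist b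

/-- Bruhat order on `S_n^D`. -/
def bruhatD (n : ℕ) (v w : Equiv.Perm ℤ) : Prop :=
  ∃ a b : List ℕ, ReducedD n a v ∧ ReducedD n b w ∧ a.Sublist b

/-- `w` is an element of `S_n^B`: an "odd" permutation of `{±1, …, ±n}`. -/
def IsSignedPerm (n : ℕ) (w : Equiv.Perm ℤ) : Prop :=
  (∀ x : ℤ, w (-x) = - w x) ∧ ∀ x : ℤ, (n : ℤ) < |x| → w x = x

/-- `w` is an element of `S_n^D`: a signed permutation with an even number of
negative values in its one-line notation. -/
def IsTypeD (n : ℕ) (w : Equiv.Perm ℤ) : Prop :=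
  IsSignedPerm n w ∧ Even (((Finset.Icc (1 : ℤ) n).filter (fun x => w x < 0)).card)

/-- `w ∈ S_n^B` is boolean (for the type `B` Bruhat order). -/
def BooleanB (n : ℕ) (w : Equiv.Perm ℤ) : Prop :=
  ∃ (r : ℕ) (e : {v : Equiv.Perm ℤ // bruhatB n v w} ≃ Finset (Fin r)),
    ∀ a b : {v : Equiv.Perm ℤ // bruhatB n v w}, bruhatB n a.1 b.1 ↔ e a ⊆ e b

/-- `w ∈ S_n^D` is boolean (for the type `D` Bruhat order). -/
def BooleanD (n : ℕ) (w : Equiv.Perm ℤ) : Prop :=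
  ∃ (r : ℕ) (e : {v : Equiv.Perm ℤ // bruhatD n v w} ≃ Finset (Fin r)),
    ∀ a b : {v : Equiv.Perm ℤ // bruhatD n v w}, bruhatD n a.1 b.1 ↔ e a ⊆ e b

/-- Signed pattern containment, where the pattern is given by its one-line
notation `p` (a list of nonzero integers): there are positions
`1 ≤ f 0 < ⋯ < f (k-1) ≤ n` such that each `w (f j)` has the same sign as the
`j`-th entry of `p`, and the absolute values appear in the same relative order. -/
def containsPat (n : ℕ) (w : Equiv.Perm ℤ) (p : List ℤ) : Prop :=
  ∃ f : Fin p.length → ℤ, StrictMono f ∧ (∀ j, 1 ≤ f j ∧ f j ≤ (n : ℤ)) ∧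
    (∀ j, 0 < w (f j) ↔ 0 < p.get j) ∧
    (∀ j j', |w (f j)| < |w (f j')| ↔ |p.get j| < |p.get j'|)

/-- Signed pattern avoidance. -/
def avoidsPat (n : ℕ) (w : Equiv.Perm ℤ) (p : List ℤ) : Prop := ¬ containsPat n w p


/-! ### Extra definitions used in some statements -/

/-- `w ∈ S_n` is decomposable: `B(w) ≅ B(u) × B(v)` (as posets under Bruhat order)
for some `u ∈ S_m`, `v ∈ S_{m'}` with `m, m' < n`. -/
def Decomposable (n : ℕ) (w : Equiv.Perm (Fin n)) : Prop :=
  ∃ (m m' : ℕ), m < n ∧ m' < n ∧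
    ∃ (u : Equiv.Perm (Fin m)) (v : Equiv.Perm (Fin m'))
      (e : {x : Equiv.Perm (Fin n) // bruhatA n x w} ≃
        {y : Equiv.Perm (Fin m) // bruhatA m y u} × {z : Equiv.Perm (Fin m') // bruhatA m' z v}),
      ∀ a b : {x : Equiv.Perm (Fin n) // bruhatA n x w},
        bruhatA n a.1 b.1 ↔
          (bruhatA m ((e a).1).1 ((e b).1).1 ∧ bruhatA m' ((e a).2).1 ((e b).2).1)

/-- `w` is decreasing on the set of positions `T`. -/
def DecrOn (n : ℕ) (w : Equiv.Perm (Fin n)) (T : Finset (Fin n)) : Prop :=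
  ∀ a ∈ T, ∀ b ∈ T, a < b → w b < w a

/-- Every inversion of `w` lies in exactly one occurrence of the decreasing
pattern `w_0^{(k)}`: for every `i < j` with `w i > w j` there is exactly one
`k`-element set of positions containing `i` and `j` on which `w` is decreasing. -/
def EveryInvOnce (n k : ℕ) (w : Equiv.Perm (Fin n)) : Prop :=
  ∀ i j : Fin n, i < j → w j < w i →
    ∃! T : Finset (Fin n), T.card = k ∧ DecrOn n w T ∧ i ∈ T ∧ j ∈ T

/-- Equality of two patterns of (possibly a priori different) sizes. -/
def EqPat {k m : ℕ} (p : Equiv.Perm (Fin k)) (q : Equiv.Perm (Fin m)) : Prop :=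
  ∃ h : k = m, ∀ i : Fin k, ((p i : ℕ) = (q (Fin.cast h i) : ℕ))

/-- `L(n,k)`: the number of boolean permutations in `S_n` of length `k`. -/
noncomputable def LA (n k : ℕ) : ℕ :=
  Nat.card {w : Equiv.Perm (Fin n) // BooleanA n w ∧ lenA n w = k}

/-- `L` extended to integer arguments, with the convention that it vanishes
when `m < 1` or `j < 0`. -/
noncomputable def Lz (m j : ℤ) : ℤ :=
  if 1 ≤ m ∧ 0 ≤ j then (LA m.toNat j.toNat : ℤ) else 0

/-- `L^D(n,k)`: the number of boolean elements of `S_n^D` of length `k`. -/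
noncomputable def LD (n k : ℕ) : ℕ :=
  Nat.card {w : Equiv.Perm ℤ // IsTypeD n w ∧ BooleanD n w ∧ lenD n w = k}

theorem app_inv {n : ℕ} (x : Equiv.Perm (Fin n)) (p : Fin n) : x (x⁻¹ p) = p :=
  x.apply_symm_apply p

theorem inv_app {n : ℕ} (x : Equiv.Perm (Fin n)) (p : Fin n) : x⁻¹ (x p) = p :=
  x.symm_apply_apply p

/-! ### Words and strong exchange -/

theorem sA_val {n k : ℕ} (h1 : 1 ≤ k) (h2 : k < n) (p : Fin n) :
    (p.val = k - 1 ∧ (sA n k p).val = k) ∨ (p.val = k ∧ (sA n k p).val = k - 1) ∨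
      (p.val ≠ k - 1 ∧ p.val ≠ k ∧ (sA n k p).val = p.val) := by
  unfold sA
  rw [dif_pos ⟨h1, h2⟩]
  by_cases hp : p.val = k - 1
  · left
    refine ⟨hp, ?_⟩
    have : p = ⟨k - 1, by omega⟩ := Fin.ext hp
    rw [this, Equiv.swap_apply_left]
  · by_cases hq : p.val = k
    · right; left
      refine ⟨hq, ?_⟩
      have : p = ⟨k, h2⟩ := Fin.ext hq
      rw [this, Equiv.swap_apply_right]
    · right; right
      refine ⟨hp, hq, ?_⟩
      rw [Equiv.swap_apply_of_ne_of_ne]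
      · intro h; apply hp; rw [h]
      · intro h; apply hq; rw [h]

theorem sA_sq (n k : ℕ) : sA n k * sA n k = 1 := by
  unfold sA
  split_ifs <;> simp

theorem sA_inv (n k : ℕ) : (sA n k)⁻¹ = sA n k :=
  inv_eq_of_mul_eq_one_left (sA_sq n k)

theorem sA_cancel {n : ℕ} (k : ℕ) (x : Equiv.Perm (Fin n)) : sA n k * (sA n k * x) = x := by
  rw [← mul_assoc, sA_sq, one_mul]

theorem sA_sA {n : ℕ} (k : ℕ) (p : Fin n) : sA n k (sA n k p) = p := by
  rw [← Equiv.Perm.mul_apply, sA_sq]; rfl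

theorem prodA_nil (n : ℕ) : prodA n [] = 1 := rfl

theorem prodA_cons (n j : ℕ) (b : List ℕ) : prodA n (j :: b) = sA n j * prodA n b := by
  simp [prodA]

theorem prodA_append (n : ℕ) (a b : List ℕ) : prodA n (a ++ b) = prodA n a * prodA n b := by
  simp [prodA]

theorem prodA_reverse (n : ℕ) (a : List ℕ) : prodA n a.reverse = (prodA n a)⁻¹ := by
  induction a with
  | nil => simp [prodA]
  | cons j b ih =>
    rw [List.reverse_cons, prodA_append, prodA_cons, prodA_cons, prodA_nil, ih, mul_one,
      mul_inv_rev, sA_inv]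

theorem exch_aux {n : ℕ} (b : List ℕ) : IsWordA n b → ∀ p q : Fin n, p < q →
    (prodA n b)⁻¹ q < (prodA n b)⁻¹ p →
    ∃ b1 j b2, b = b1 ++ j :: b2 ∧ Equiv.swap p q * prodA n b1 = prodA n b1 * sA n j := by
  induction b with
  | nil =>
    intro _ p q hpq h
    simp [prodA] at h
    exact absurd hpq (lt_asymm h)
  | cons j b ih =>
    intro hb p q hpq h
    have hj := hb j (by simp)
    have hb' : IsWordA n b := fun i hi => hb i (by simp [hi])
    have hn : j < n := by have := p.2; omega
    by_cases hc : p.val = j - 1 ∧ q.val = j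
    · refine ⟨[], j, b, rfl, ?_⟩
      have hp : p = ⟨j - 1, by omega⟩ := Fin.ext hc.1
      have hq : q = ⟨j, hn⟩ := Fin.ext hc.2
      rw [prodA_nil, mul_one, one_mul, sA, dif_pos ⟨hj.1, hn⟩]
      congr 1
    · have hlt : sA n j p < sA n j q := by
        have h1 := sA_val hj.1 hn p
        have h2 := sA_val hj.1 hn q
        rw [Fin.lt_def] at *
        omega
      rw [prodA_cons, mul_inv_rev, sA_inv, Equiv.Perm.mul_apply, Equiv.Perm.mul_apply] at h
      obtain ⟨b1, i, b2, hbe, hs⟩ := ih hb' _ _ hlt h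
      refine ⟨j :: b1, i, b2, by rw [hbe]; rfl, ?_⟩
      have := Equiv.mul_swap_eq_swap_mul (sA n j) (sA n j p) (sA n j q)
      rw [sA_sA, sA_sA] at this
      rw [prodA_cons, ← mul_assoc, ← this, mul_assoc, hs, mul_assoc]

theorem exch {n : ℕ} (b : List ℕ) (hb : IsWordA n b) (p q : Fin n) (hpq : p < q)
    (h : (prodA n b)⁻¹ q < (prodA n b)⁻¹ p) :
    ∃ b1 j b2, b = b1 ++ j :: b2 ∧ Equiv.swap p q * prodA n b1 = prodA n b1 * sA n j ∧
      Equiv.swap p q * prodA n b = prodA n (b1 ++ b2) := by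
  obtain ⟨b1, j, b2, e, hs⟩ := exch_aux b hb p q hpq h
  refine ⟨b1, j, b2, e, hs, ?_⟩
  rw [e, prodA_append, prodA_append, prodA_cons, ← mul_assoc, hs, mul_assoc, sA_cancel]

/-- `x` preserves the set of the first `k` positions. -/
def Pres {n : ℕ} (k : ℕ) (x : Equiv.Perm (Fin n)) : Prop :=
  ∀ p : Fin n, (x p).val < k ↔ p.val < k

theorem Pres.inv {n k : ℕ} {x : Equiv.Perm (Fin n)} (h : Pres k x) : Pres k x⁻¹ := by
  intro p
  rw [← h (x⁻¹ p), app_inv]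

theorem pres_word {n k : ℕ} (b : List ℕ) (hb : IsWordA n b) (hk : k ∉ b) :
    Pres k (prodA n b) := by
  induction b with
  | nil => intro p; rfl
  | cons j b ih =>
    intro p
    have hj := hb j (by simp)
    have hn : j < n := by have := p.2; omega
    have hb' : IsWordA n b := fun i hi => hb i (by simp [hi])
    have hkj : k ≠ j := fun h => hk (by simp [h])
    have := ih hb' (fun h => hk (by simp [h])) p
    have h1 := sA_val hj.1 hn (prodA n b p)
    rw [prodA_cons, Equiv.Perm.mul_apply]
    omega

theorem word_sublist {n : ℕ} {a b : List ℕ} (h : a.Sublist b) (hb : IsWordA n b) :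
    IsWordA n a := fun i hi => hb i (h.subset hi)

theorem word_lt {n k : ℕ} {b : List ℕ} (hb : IsWordA n b) (hk : k ∈ b) : 1 ≤ k ∧ k < n := by
  have := hb k hk
  omega

theorem first_split {k : ℕ} (b : List ℕ) (hk : k ∈ b) :
    ∃ b1 b2, b = b1 ++ k :: b2 ∧ k ∉ b1 := by
  obtain ⟨b1, b2, h1, h2⟩ := List.append_of_mem hk |> fun _ => List.eq_append_cons_of_mem hk
  exact ⟨b1, b2, h1, h2⟩

/-- Reduced words of elements preserving the first `k` positions do not use the letter `k`. -/
theorem support {n k : ℕ} {b : List ℕ} {x : Equiv.Perm (Fin n)} (hb : ReducedA n b x)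
    (hx : Pres k x) : k ∉ b := by
  intro hk
  obtain ⟨hw, hp, hmin⟩ := hb
  obtain ⟨h1, h2⟩ := word_lt hw hk
  obtain ⟨b1, b2, e, hkb⟩ := first_split b hk
  have hs1 : b1.Sublist b := by rw [e]; exact List.sublist_append_left _ _
  have hs12 : (b1 ++ b2).Sublist b := by
    rw [e]; exact (List.Sublist.refl _).append (List.sublist_cons_self _ _)
  have hw1 := word_sublist hs1 hw
  have hw12 := word_sublist hs12 hw
  have hu := pres_word b1 hw1 hkb
  set u := prodA n b1 with hudef
  set p0 : Fin n := ⟨k - 1, by omega⟩ with hp0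
  set q0 : Fin n := ⟨k, h2⟩ with hq0
  have hup : (u p0).val < k := (hu p0).2 (by simp [hp0]; omega)
  have huq : ¬ (u q0).val < k := fun h => by
    have := (hu q0).1 h
    simp [hq0] at this
  have hsk : sA n k = Equiv.swap p0 q0 := by rw [sA, dif_pos ⟨h1, h2⟩]
  have ht : Equiv.swap (u p0) (u q0) * x = prodA n (b1 ++ b2) := by
    rw [← hp, e, prodA_append, prodA_append, prodA_cons, ← mul_assoc,
      ← Equiv.mul_swap_eq_swap_mul, mul_assoc, ← hsk, sA_cancel]
  have hx' : x = Equiv.swap (u p0) (u q0) * prodA n (b1 ++ b2) := by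
    rw [← ht, ← mul_assoc, Equiv.swap_mul_self, one_mul]
  have hlt : u p0 < u q0 := by rw [Fin.lt_def]; omega
  have hinv : (prodA n (b1 ++ b2))⁻¹ (u q0) < (prodA n (b1 ++ b2))⁻¹ (u p0) := by
    rw [← ht, mul_inv_rev, Equiv.swap_inv, Equiv.Perm.mul_apply, Equiv.Perm.mul_apply,
      Equiv.swap_apply_left, Equiv.swap_apply_right, Fin.lt_def]
    have e1 := hx.inv (u p0)
    have e2 := hx.inv (u q0)
    omega
  obtain ⟨c1, j, c2, ec, _, hc⟩ := exch _ hw12 _ _ hlt hinv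
  rw [← hx'] at hc
  have hwc : IsWordA n (c1 ++ c2) := by
    apply word_sublist _ hw12
    rw [ec]; exact (List.Sublist.refl _).append (List.sublist_cons_self _ _)
  have hl := hmin _ hwc hc.symm
  have l1 := congrArg List.length e
  have l2 := congrArg List.length ec
  simp at hl l1 l2
  omega

theorem word_cons {n k : ℕ} {b : List ℕ} (h1 : 1 ≤ k) (h2 : k < n) (hb : IsWordA n b) :
    IsWordA n (k :: b) := by
  intro i hi
  rcases List.mem_cons.1 hi with rfl | h
  · omega
  · exact hb i h

/-- Exchange for a simple letter. -/
theorem exch_simple {n k : ℕ} (h1 : 1 ≤ k) (h2 : k < n) (b : List ℕ) (hb : IsWordA n b)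
    (h : (prodA n b)⁻¹ ⟨k, h2⟩ < (prodA n b)⁻¹ ⟨k - 1, by omega⟩) :
    ∃ b1 j b2, b = b1 ++ j :: b2 ∧ sA n k * prodA n b1 = prodA n b1 * sA n j ∧
      sA n k * prodA n b = prodA n (b1 ++ b2) := by
  have := exch b hb ⟨k - 1, by omega⟩ ⟨k, h2⟩ (by rw [Fin.lt_def]; simp; omega) h
  rw [sA, dif_pos ⟨h1, h2⟩]
  exact this

theorem reduced_cons {n k : ℕ} (h1 : 1 ≤ k) (h2 : k < n) {b : List ℕ} {x : Equiv.Perm (Fin n)}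
    (hb : ReducedA n b (sA n k * x))
    (h : x⁻¹ ⟨k, h2⟩ < x⁻¹ ⟨k - 1, by omega⟩) : ReducedA n (k :: b) x := by
  obtain ⟨hw, hp, hmin⟩ := hb
  refine ⟨word_cons h1 h2 hw, by rw [prodA_cons, hp, sA_cancel], ?_⟩
  intro c hc hcp
  rw [← hcp] at h
  obtain ⟨c1, j, c2, e, _, hd⟩ := exch_simple h1 h2 c hc h
  have hwc : IsWordA n (c1 ++ c2) := by
    apply word_sublist _ hc
    rw [e]; exact (List.Sublist.refl _).append (List.sublist_cons_self _ _)
  have := hmin _ hwc (by rw [← hd, hcp])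
  have l := congrArg List.length e
  simp at this l ⊢
  omega

theorem pres_desc {n k : ℕ} (h1 : 1 ≤ k) (h2 : k < n) {x : Equiv.Perm (Fin n)} (hx : Pres k x) :
    (sA n k * x)⁻¹ ⟨k, h2⟩ < (sA n k * x)⁻¹ ⟨k - 1, by omega⟩ := by
  rw [mul_inv_rev, sA_inv, Equiv.Perm.mul_apply, Equiv.Perm.mul_apply, Fin.lt_def]
  have a1 := sA_val h1 h2 ⟨k, h2⟩
  have a2 := sA_val h1 h2 ⟨k - 1, by omega⟩
  have a3 := hx.inv (sA n k ⟨k, h2⟩)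
  have a4 := hx.inv (sA n k ⟨k - 1, by omega⟩)
  simp at a1 a2
  omega

theorem reduced_cons_pres {n k : ℕ} (h1 : 1 ≤ k) (h2 : k < n) {b : List ℕ}
    {x : Equiv.Perm (Fin n)} (hb : ReducedA n b x) (hx : Pres k x) :
    ReducedA n (k :: b) (sA n k * x) := by
  apply reduced_cons h1 h2
  · rw [sA_cancel]; exact hb
  · exact pres_desc h1 h2 hx

theorem not_pres {n k : ℕ} (h1 : 1 ≤ k) (h2 : k < n) {x : Equiv.Perm (Fin n)} (hx : Pres k x) :
    ¬ Pres k (sA n k * x) := by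
  intro h
  have e := h (x⁻¹ ⟨k, h2⟩)
  have e2 := hx.inv ⟨k, h2⟩
  rw [Equiv.Perm.mul_apply, app_inv] at e
  have a1 := sA_val h1 h2 ⟨k, h2⟩
  simp only [] at a1 e2
  omega

theorem exists_word {n : ℕ} (x : Equiv.Perm (Fin n)) : ∃ b, IsWordA n b ∧ prodA n b = x := by
  cases n with
  | zero => exact ⟨[], by intro i hi; simp at hi, Subsingleton.elim _ _⟩
  | succ n =>
    have hx : x ∈ Submonoid.closure (Set.range fun i : Fin n ↦ Equiv.swap i.castSucc i.succ) := by
      rw [Equiv.Perm.mclosure_swap_castSucc_succ]; trivial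
    induction hx using Submonoid.closure_induction with
    | mem y hy =>
      obtain ⟨i, rfl⟩ := hy
      refine ⟨[i.val + 1], ?_, ?_⟩
      · intro j hj
        have := i.2
        simp at hj
        omega
      · rw [prodA_cons, prodA_nil, mul_one, sA, dif_pos ⟨by omega, by have := i.2; omega⟩]
        rfl
    | one => exact ⟨[], by intro i hi; simp at hi, rfl⟩
    | mul y z _ _ hy hz =>
      obtain ⟨a, ha, rfl⟩ := hy
      obtain ⟨b, hb, rfl⟩ := hz
      refine ⟨a ++ b, ?_, prodA_append _ _ _⟩
      intro i hi
      rcases List.mem_append.1 hi with h | h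
      · exact ha i h
      · exact hb i h

theorem exists_reduced {n : ℕ} (x : Equiv.Perm (Fin n)) :
    ∃ b, ReducedA n b x ∧ b.length = lenA n x := by
  have hne : {l | ∃ w : List ℕ, IsWordA n w ∧ prodA n w = x ∧ w.length = l}.Nonempty := by
    obtain ⟨b, hb, hp⟩ := exists_word x
    exact ⟨_, b, hb, hp, rfl⟩
  obtain ⟨b, hb, hp, hl⟩ := Nat.sInf_mem hne
  refine ⟨b, ⟨hb, hp, ?_⟩, hl⟩
  intro c hc hcp
  rw [hl]
  exact Nat.sInf_le ⟨c, hc, hcp, rfl⟩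

theorem reduced_len {n : ℕ} {x : Equiv.Perm (Fin n)} {b : List ℕ} (hb : ReducedA n b x) :
    lenA n x = b.length := by
  obtain ⟨c, hc, hl⟩ := exists_reduced x
  rw [← hl]
  exact le_antisymm (hc.2.2 _ hb.1 hb.2.1) (hb.2.2 _ hc.1 hc.2.1)

theorem len_step {n k : ℕ} (h1 : 1 ≤ k) (h2 : k < n) {x : Equiv.Perm (Fin n)} (hx : Pres k x) :
    lenA n (sA n k * x) = lenA n x + 1 := by
  obtain ⟨b, hb, hl⟩ := exists_reduced x
  rw [reduced_len (reduced_cons_pres h1 h2 hb hx), ← hl]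
  rfl

/-! ### Inverses -/

theorem reduced_inv {n : ℕ} {x : Equiv.Perm (Fin n)} {b : List ℕ} (hb : ReducedA n b x) :
    ReducedA n b.reverse x⁻¹ := by
  obtain ⟨hw, hp, hmin⟩ := hb
  refine ⟨fun i hi => hw i (by simpa using hi), by rw [prodA_reverse, hp], ?_⟩
  intro c hc hcp
  have := hmin c.reverse (fun i hi => hc i (by simpa using hi))
    (by rw [prodA_reverse, hcp, inv_inv])
  simpa using this

theorem len_inv {n : ℕ} (x : Equiv.Perm (Fin n)) : lenA n x⁻¹ = lenA n x := by
  obtain ⟨b, hb, hl⟩ := exists_reduced x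
  rw [reduced_len (reduced_inv hb), ← hl, List.length_reverse]

theorem bruhat_inv {n : ℕ} {v w : Equiv.Perm (Fin n)} (h : bruhatA n v w) :
    bruhatA n v⁻¹ w⁻¹ := by
  obtain ⟨a, b, ha, hb, hab⟩ := h
  exact ⟨_, _, reduced_inv ha, reduced_inv hb, hab.reverse⟩

theorem card_inv {n : ℕ} (w : Equiv.Perm (Fin n)) :
    Nat.card {v : Equiv.Perm (Fin n) // bruhatA n v w⁻¹} =
      Nat.card {v : Equiv.Perm (Fin n) // bruhatA n v w} := by
  apply Nat.card_congr
  refine ⟨fun v => ⟨v.1⁻¹, ?_⟩, fun v => ⟨v.1⁻¹, bruhat_inv v.2⟩, ?_, ?_⟩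
  · have := bruhat_inv v.2
    rwa [inv_inv] at this
  · intro v; simp
  · intro v; simp

/-! ### The doubling step -/

theorem bruhat_pres {n k : ℕ} {v w : Equiv.Perm (Fin n)} (hw : Pres k w) (h : bruhatA n v w) :
    Pres k v := by
  obtain ⟨a, b, ha, hb, hab⟩ := h
  have := support hb hw
  rw [← ha.2.1]
  exact pres_word a ha.1 (fun h => this (hab.subset h))

theorem sA_comm {n j k : ℕ} (h : j + 1 < k ∨ k + 1 < j) (hj1 : 1 ≤ j) (hj2 : j < n)
    (hk1 : 1 ≤ k) (hk2 : k < n) : sA n j * sA n k = sA n k * sA n j := by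
  ext p
  rw [Equiv.Perm.mul_apply, Equiv.Perm.mul_apply]
  have a1 := sA_val hj1 hj2 p
  have a2 := sA_val hk1 hk2 p
  have a3 := sA_val hj1 hj2 (sA n k p)
  have a4 := sA_val hk1 hk2 (sA n j p)
  omega

theorem word_comm {n k : ℕ} (hk1 : 1 ≤ k) (hk2 : k < n) (a : List ℕ) (ha : IsWordA n a)
    (h : ∀ j ∈ a, j + 1 < k ∨ k + 1 < j) : prodA n a * sA n k = sA n k * prodA n a := by
  induction a with
  | nil => simp [prodA]
  | cons j a ih =>
    obtain ⟨hj1, hj2⟩ := word_lt ha (List.mem_cons_self (a := j) (l := a))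
    rw [prodA_cons, mul_assoc, ih (fun i hi => ha i (by simp [hi])) (fun i hi => h i (by simp [hi])),
      ← mul_assoc, sA_comm (h j (by simp)) hj1 hj2 hk1 hk2, mul_assoc]

theorem bruhat_step {n k : ℕ} (h1 : 1 ≤ k) (h2 : k < n) {x v : Equiv.Perm (Fin n)}
    (hx : Pres k x) :
    bruhatA n v (sA n k * x) ↔ bruhatA n v x ∨ bruhatA n (sA n k * v) x := by
  constructor
  · rintro ⟨a, b, ha, hb, hab⟩
    have hd := pres_desc h1 h2 hx
    rw [← hb.2.1] at hd
    obtain ⟨b1, j, b2, e, hcomm, hdel⟩ := exch_simple h1 h2 b hb.1 hd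
    rw [hb.2.1, sA_cancel] at hdel
    have hl := congrArg List.length e
    have hs12 : (b1 ++ b2).Sublist b := by
      rw [e]; exact (List.Sublist.refl _).append (List.sublist_cons_self _ _)
    have hw12 := word_sublist hs12 hb.1
    have hr : ReducedA n (b1 ++ b2) x := by
      refine ⟨hw12, hdel.symm, ?_⟩
      intro c hc hcp
      have := hb.2.2 (k :: c) (word_cons h1 h2 hc) (by rw [prodA_cons, hcp])
      simp at this hl ⊢
      omega
    have hk12 := support hr hx
    have hk1 : k ∉ b1 := fun h => hk12 (List.mem_append_left _ h)
    have hk2 : k ∉ b2 := fun h => hk12 (List.mem_append_right _ h)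
    have hjk : j = k := by
      by_contra hne
      apply not_pres h1 h2 hx
      rw [← hb.2.1]
      apply pres_word b hb.1
      rw [e]
      intro h
      rcases List.mem_append.1 h with h | h
      · exact hk1 h
      · rcases List.mem_cons.1 h with h | h
        · exact hne h.symm
        · exact hk2 h
    subst hjk
    have hw1 : IsWordA n b1 := word_sublist (List.sublist_append_left _ _) hw12
    have hr1 : ReducedA n b1 (prodA n b1) := by
      refine ⟨hw1, rfl, ?_⟩
      intro c hc hcp
      have := hr.2.2 (c ++ b2) (by
        intro i hi
        rcases List.mem_append.1 hi with h | h
        · exact hc i h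
        · exact hw12 i (List.mem_append_right _ h)) (by
        rw [prodA_append, hcp, ← prodA_append, hdel])
      simp at this
      exact this
    have hu := pres_word b1 hw1 hk1
    set u := prodA n b1 with hudef
    -- u fixes j-1 and j
    have hfix : ∀ p : Fin n, (p.val = j - 1 ∨ p.val = j) → (u p).val = p.val := by
      intro p hp
      have c1 := congrArg (fun f : Equiv.Perm (Fin n) => (f p).val) hcomm
      simp only [Equiv.Perm.mul_apply] at c1
      have a1 := sA_val h1 h2 (u p)
      have a2 := sA_val h1 h2 p
      have a3 := hu p
      have a4 := hu (sA n j p)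
      omega
    have hlow : ∀ p : Fin n, (u p).val = j - 1 ∨ (u p).val = j → u p = p := by
      intro p hp
      have := hfix (u p) hp
      exact u.injective (Fin.ext this)
    have hpm : Pres (j - 1) u := by
      intro p
      have a1 := hu p
      have a2 := hfix p
      have a3 := fun h => congrArg Fin.val (hlow p h)
      omega
    have hpp : Pres (j + 1) u := by
      intro p
      have a1 := hu p
      have a2 := hfix p
      have a3 := fun h => congrArg Fin.val (hlow p h)
      omega
    have hnm := support hr1 hpm
    have hnp := support hr1 hpp
    rw [e] at hab
    obtain ⟨a1, a2, rfl, hs1, hs2⟩ := List.sublist_append_iff.1 hab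
    rcases List.sublist_cons_iff.1 hs2 with hs2 | ⟨a3, rfl, hs3⟩
    · left
      exact ⟨_, _, ha, hr, hs1.append hs2⟩
    · right
      have hc : prodA n a1 * sA n j = sA n j * prodA n a1 := by
        apply word_comm h1 h2 a1 (word_sublist hs1 hw1)
        intro i hi
        have hi' := hs1.subset hi
        have hne1 : i ≠ j := fun h => hk1 (h ▸ hi')
        have hne2 : i ≠ j - 1 := fun h => hnm (h ▸ hi')
        have hne3 : i ≠ j + 1 := fun h => hnp (h ▸ hi')
        omega
      have hv : v = sA n j * prodA n (a1 ++ a3) := by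
        rw [← ha.2.1, prodA_append, prodA_append, prodA_cons, ← mul_assoc, hc, mul_assoc]
      refine ⟨a1 ++ a3, b1 ++ b2, ⟨?_, ?_, ?_⟩, hr, hs1.append hs3⟩
      · exact word_sublist (hs1.append hs3) hw12
      · rw [hv, sA_cancel]
      · intro c hcw hcp
        have := ha.2.2 (j :: c) (word_cons h1 h2 hcw) (by rw [prodA_cons, hcp, sA_cancel])
        simp at this ⊢
        omega
  · rintro (⟨a, b, ha, hb, hab⟩ | ⟨a, b, ha, hb, hab⟩)
    · exact ⟨a, k :: b, ha, reduced_cons_pres h1 h2 hb hx, hab.cons _⟩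
    · have hp : Pres k (sA n k * v) := bruhat_pres hx ⟨a, b, ha, hb, hab⟩
      have := reduced_cons_pres h1 h2 ha hp
      rw [sA_cancel] at this
      exact ⟨k :: a, k :: b, this, reduced_cons_pres h1 h2 hb hx, hab.cons_cons _⟩

theorem card_step {n k : ℕ} (h1 : 1 ≤ k) (h2 : k < n) {x : Equiv.Perm (Fin n)}
    (hx : Pres k x) :
    Nat.card {v : Equiv.Perm (Fin n) // bruhatA n v (sA n k * x)} =
      2 * Nat.card {v : Equiv.Perm (Fin n) // bruhatA n v x} := by
  classical
  have hdis : Disjoint (fun v : Equiv.Perm (Fin n) => bruhatA n v x)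
      (fun v => bruhatA n (sA n k * v) x) := by
    rw [Pi.disjoint_iff]
    intro v
    rw [Prop.disjoint_iff]
    by_contra h
    exact not_pres h1 h2 (bruhat_pres hx h.1) (bruhat_pres hx h.2)
  have e1 : Nat.card {v : Equiv.Perm (Fin n) // bruhatA n v (sA n k * x)} =
      Nat.card {v : Equiv.Perm (Fin n) // bruhatA n v x ∨ bruhatA n (sA n k * v) x} :=
    Nat.card_congr (Equiv.subtypeEquivRight fun v => bruhat_step h1 h2 hx)
  have e2 : Nat.card {v : Equiv.Perm (Fin n) // bruhatA n (sA n k * v) x} =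
      Nat.card {v : Equiv.Perm (Fin n) // bruhatA n v x} :=
    Nat.card_congr (Equiv.subtypeEquiv (Equiv.mulLeft (sA n k)) fun v => Iff.rfl)
  rw [e1, Nat.card_congr (subtypeOrEquiv _ _ hdis), Nat.card_sum, e2]
  ring

/-! ### The base case -/

theorem reduced_nil (n : ℕ) : ReducedA n [] (1 : Equiv.Perm (Fin n)) :=
  ⟨by intro i hi; simp at hi, rfl, by intro c _ _; simp⟩

theorem card_three {n k : ℕ} (h1 : 1 ≤ k) (h2 : k + 1 < n) :
    Nat.card {p : Fin n // k - 1 ≤ p.val ∧ p.val ≤ k + 1} = 3 := by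
  have e : {p : Fin n // k - 1 ≤ p.val ∧ p.val ≤ k + 1} ≃ Fin 3 :=
    { toFun := fun p => ⟨p.1.val - (k - 1), by have := p.2; omega⟩
      invFun := fun q => ⟨⟨q.val + (k - 1), by have := q.2; omega⟩,
        by have := q.2; constructor <;> (simp only []; omega)⟩
      left_inv := by
        intro p
        have := p.2
        apply Subtype.ext
        apply Fin.ext
        simp only []
        omega
      right_inv := by
        intro q
        apply Fin.ext
        simp only []
        omega }
  rw [Nat.card_congr e, Nat.card_eq_fintype_card, Fintype.card_fin]

set_option maxHeartbeats 2000000 in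
theorem base {n k : ℕ} (h1 : 1 ≤ k) (h2 : k + 1 < n) {w : Equiv.Perm (Fin n)}
    (hw : ∀ p : Fin n, (p.val = k - 1 ∧ (w p).val = k + 1) ∨ (p.val = k ∧ (w p).val = k) ∨
      (p.val = k + 1 ∧ (w p).val = k - 1) ∨
      ((p.val < k - 1 ∨ k + 1 < p.val) ∧ (w p).val = p.val)) :
    Nat.card {v : Equiv.Perm (Fin n) // bruhatA n v w} = 6 ∧ lenA n w = 3 := by
  have hk : k < n := by omega
  have h1' : 1 ≤ k + 1 := by omega
  have hs := fun p : Fin n => sA_val h1 hk p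
  have ht := fun p : Fin n => sA_val h1' h2 p
  have p1 : ∀ m, Pres m (1 : Equiv.Perm (Fin n)) := fun m p => Iff.rfl
  have rs : ReducedA n [k] (sA n k * 1) := reduced_cons_pres h1 hk (reduced_nil n) (p1 _)
  have rt : ReducedA n [k + 1] (sA n (k + 1) * 1) :=
    reduced_cons_pres h1' h2 (reduced_nil n) (p1 _)
  have ps : Pres (k + 1) (sA n k * 1) := by
    intro p
    rw [mul_one]
    have := hs p
    omega
  have pt : Pres k (sA n (k + 1) * 1) := by
    intro p
    rw [mul_one]
    have := ht p
    omega
  have rts : ReducedA n [k + 1, k] (sA n (k + 1) * (sA n k * 1)) :=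
    reduced_cons_pres h1' h2 rs ps
  have rst : ReducedA n [k, k + 1] (sA n k * (sA n (k + 1) * 1)) :=
    reduced_cons_pres h1 hk rt pt
  have ew : w = sA n k * (sA n (k + 1) * (sA n k * 1)) := by
    ext p
    simp only [Equiv.Perm.mul_apply, mul_one]
    have a1 := hs p
    have a2 := ht (sA n k p)
    have a3 := hs (sA n (k + 1) (sA n k p))
    have a4 := hw p
    omega
  have rfull : ReducedA n [k, k + 1, k] w := by
    apply reduced_cons h1 hk
    · rw [ew, sA_cancel]; exact rts
    · have b1 := hw (w⁻¹ ⟨k, hk⟩)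
      have b2 := hw (w⁻¹ ⟨k - 1, by omega⟩)
      rw [app_inv] at b1 b2
      simp only [] at b1 b2
      rw [Fin.lt_def]
      omega
  refine ⟨?_, by rw [reduced_len rfull]; rfl⟩
  have key : ∀ v : Equiv.Perm (Fin n), bruhatA n v w ↔
      ∀ p : Fin n, ¬ (k - 1 ≤ p.val ∧ p.val ≤ k + 1) → v p = p := by
    intro v
    constructor
    · intro hv p hp
      have hpw : ∀ m, m ≠ k → m ≠ k + 1 → Pres m w := by
        intro m hm hm' p
        have := hw p
        omega
      have c1 := bruhat_pres (hpw p.val (by omega) (by omega)) hv p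
      have c2 := bruhat_pres (hpw (p.val + 1) (by omega) (by omega)) hv p
      apply Fin.ext
      omega
    · intro hv
      have hv' : ∀ p : Fin n, ¬ (k - 1 ≤ p.val ∧ p.val ≤ k + 1) → (v p).val = p.val :=
        fun p hp => congrArg Fin.val (hv p hp)
      have hin : ∀ p : Fin n, (k - 1 ≤ p.val ∧ p.val ≤ k + 1) →
          (k - 1 ≤ (v p).val ∧ (v p).val ≤ k + 1) := by
        intro p hp
        by_contra hc
        have := hv (v p) hc
        rw [v.injective this] at hc
        exact hc hp
      have hinj : ∀ p q : Fin n, p.val ≠ q.val → (v p).val ≠ (v q).val := by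
        intro p q hpq h
        exact hpq (congrArg Fin.val (v.injective (Fin.ext h)))
      obtain ⟨a, ha⟩ : ∃ a : Fin n, a.val = k - 1 := ⟨⟨k - 1, by omega⟩, rfl⟩
      obtain ⟨b, hb⟩ : ∃ a : Fin n, a.val = k := ⟨⟨k, by omega⟩, rfl⟩
      obtain ⟨c, hc⟩ : ∃ a : Fin n, a.val = k + 1 := ⟨⟨k + 1, by omega⟩, rfl⟩
      have ia := hin a (by omega)
      have ib := hin b (by omega)
      have ic := hin c (by omega)
      have nab := hinj a b (by omega)
      have nac := hinj a c (by omega)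
      have nbc := hinj b c (by omega)
      have ext3 : ∀ u : Equiv.Perm (Fin n),
          (∀ p : Fin n, ¬ (k - 1 ≤ p.val ∧ p.val ≤ k + 1) → (u p).val = p.val) →
          (u a).val = (v a).val → (u b).val = (v b).val → (u c).val = (v c).val → u = v := by
        intro u hu ea eb ec
        ext p
        by_cases hp : k - 1 ≤ p.val ∧ p.val ≤ k + 1
        · have : p.val = a.val ∨ p.val = b.val ∨ p.val = c.val := by omega
          rcases this with h | h | h
          · rw [Fin.ext h]; exact ea
          · rw [Fin.ext h]; exact eb
          · rw [Fin.ext h]; exact ec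
        · rw [hu p hp, hv' p hp]
      have sa : (sA n k a).val = k := by
        have := hs a
        omega
      have sb : (sA n k b).val = k - 1 := by
        have := hs b
        omega
      have sc : (sA n k c).val = k + 1 := by
        have := hs c
        omega
      have ta : (sA n (k + 1) a).val = k - 1 := by
        have := ht a
        omega
      have tb : (sA n (k + 1) b).val = k + 1 := by
        have := ht b
        omega
      have tc : (sA n (k + 1) c).val = k := by
        have := ht c
        omega
      have cases6 : ((v a).val = k - 1 ∧ (v b).val = k ∧ (v c).val = k + 1) ∨
          ((v a).val = k ∧ (v b).val = k - 1 ∧ (v c).val = k + 1) ∨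
          ((v a).val = k - 1 ∧ (v b).val = k + 1 ∧ (v c).val = k) ∨
          ((v a).val = k ∧ (v b).val = k + 1 ∧ (v c).val = k - 1) ∨
          ((v a).val = k + 1 ∧ (v b).val = k - 1 ∧ (v c).val = k) ∨
          ((v a).val = k + 1 ∧ (v b).val = k ∧ (v c).val = k - 1) := by
        clear sa sb sc ta tb tc ext3
        have ja : (v a).val = k - 1 ∨ (v a).val = k ∨ (v a).val = k + 1 := by omega
        have jb : (v b).val = k - 1 ∨ (v b).val = k ∨ (v b).val = k + 1 := by omega
        have jc : (v c).val = k - 1 ∨ (v c).val = k ∨ (v c).val = k + 1 := by omega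
        rcases ja with ja | ja | ja <;> rcases jb with jb | jb | jb <;>
          first
            | (exfalso; omega)
            | (rcases jc with jc | jc | jc <;>
                first
                  | (exfalso; omega)
                  | simp only [ja, jb, jc, true_and, and_true, true_or, or_true])
      rcases cases6 with ⟨va, vb, vc⟩ | ⟨va, vb, vc⟩ | ⟨va, vb, vc⟩ | ⟨va, vb, vc⟩ |
        ⟨va, vb, vc⟩ | ⟨va, vb, vc⟩
      · have : (1 : Equiv.Perm (Fin n)) = v := by
          apply ext3
          · intro p _; rfl
          all_goals (rw [Equiv.Perm.one_apply]; omega)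
        rw [← this]
        exact ⟨_, _, reduced_nil n, rfull, by simp⟩
      · have : sA n k * 1 = v := by
          rw [mul_one]
          apply ext3
          · intro p hp
            have := hs p
            omega
          all_goals omega
        rw [← this]
        exact ⟨_, _, rs, rfull, by simp⟩
      · have : sA n (k + 1) * 1 = v := by
          rw [mul_one]
          apply ext3
          · intro p hp
            have := ht p
            omega
          all_goals omega
        rw [← this]
        exact ⟨_, _, rt, rfull, by simp⟩
      · have : sA n k * (sA n (k + 1) * 1) = v := by
          rw [mul_one]
          have d1 := hs (sA n (k + 1) a)
          have d2 := hs (sA n (k + 1) b)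
          have d3 := hs (sA n (k + 1) c)
          apply ext3
          · intro p hp
            rw [Equiv.Perm.mul_apply]
            have := hs (sA n (k + 1) p)
            have := ht p
            omega
          all_goals (rw [Equiv.Perm.mul_apply]; omega)
        rw [← this]
        exact ⟨_, _, rst, rfull, by simp⟩
      · have : sA n (k + 1) * (sA n k * 1) = v := by
          rw [mul_one]
          have d1 := ht (sA n k a)
          have d2 := ht (sA n k b)
          have d3 := ht (sA n k c)
          apply ext3
          · intro p hp
            rw [Equiv.Perm.mul_apply]
            have := ht (sA n k p)
            have := hs p
            omega
          all_goals (rw [Equiv.Perm.mul_apply]; omega)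
        rw [← this]
        exact ⟨_, _, rts, rfull, by simp⟩
      · have : w = v := by
          have d1 := hw a
          have d2 := hw b
          have d3 := hw c
          apply ext3
          · intro p hp
            have := hw p
            omega
          all_goals omega
        rw [← this]
        exact ⟨_, _, rfull, rfull, List.Sublist.refl _⟩
  rw [Nat.card_congr (Equiv.subtypeEquivRight key),
    ← Nat.card_congr (Equiv.Perm.subtypeEquivSubtypePerm
      (fun p : Fin n => k - 1 ≤ p.val ∧ p.val ≤ k + 1)), Nat.card_perm, card_three h1 h2]
  rfl

/-! ### Patterns -/

/-- No two entries jump over two smaller, later entries. -/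
def NC {n : ℕ} (w : Equiv.Perm (Fin n)) : Prop :=
  ∀ p p' q q' : Fin n, p ≠ p' → q ≠ q' → p < q → p < q' → p' < q → p' < q' →
    w q < w p → w q < w p' → w q' < w p → w q' < w p' → False

/-- `(a, b, c)` is an occurrence of `321`. -/
def Dec3 {n : ℕ} (w : Equiv.Perm (Fin n)) (a b c : Fin n) : Prop :=
  a < b ∧ b < c ∧ w b < w a ∧ w c < w b

/-- Exactly one occurrence of `321`. -/
def Uniq {n : ℕ} (w : Equiv.Perm (Fin n)) : Prop :=
  ∃ a b c, Dec3 w a b c ∧ ∀ a' b' c', Dec3 w a' b' c' → a' = a ∧ b' = b ∧ c' = c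

theorem nc_of {n : ℕ} {w : Equiv.Perm (Fin n)} (h : AvoidsA w p3412) (hu : Uniq w) : NC w := by
  obtain ⟨a, b, c, _, hun⟩ := hu
  have ordered : ∀ p p' q q' : Fin n, p < p' → q < q' → p' < q →
    w q < w p → w q < w p' → w q' < w p → w q' < w p' → False := by
    intro p p' q q' h1 h2 h3 h4 h5 h6 h7
    rcases lt_trichotomy (w p) (w p') with hp | hp | hp
    · rcases lt_trichotomy (w q) (w q') with hq | hq | hq
      · apply h
        refine ⟨![p, p', q, q'], ?_, ?_⟩
        · rw [Fin.strictMono_iff_lt_succ]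
          intro i
          fin_cases i
          · exact h1
          · exact h3
          · exact h2
        · have e0 : ![p, p', q, q'] 0 = p := rfl
          have e1 : ![p, p', q, q'] 1 = p' := rfl
          have e2 : ![p, p', q, q'] 2 = q := rfl
          have e3 : ![p, p', q, q'] 3 = q' := rfl
          have f0 : p3412 0 = 2 := rfl
          have f1 : p3412 1 = 3 := rfl
          have f2 : p3412 2 = 0 := rfl
          have f3 : p3412 3 = 1 := rfl
          intro i j
          have hi : i = 0 ∨ i = 1 ∨ i = 2 ∨ i = 3 := by omega
          have hj : j = 0 ∨ j = 1 ∨ j = 2 ∨ j = 3 := by omega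
          rcases hi with rfl | rfl | rfl | rfl <;> rcases hj with rfl | rfl | rfl | rfl <;>
            simp only [e0, e1, e2, e3, f0, f1, f2, f3, Fin.lt_def] at * <;>
            simp <;> omega
      · exact h2.ne (w.injective hq)
      · have t1 := hun p q q' ⟨h1.trans h3, h2, h4, hq⟩
        have t2 := hun p' q q' ⟨h3, h2, h5, hq⟩
        exact h1.ne (t1.1.trans t2.1.symm)
    · exact h1.ne (w.injective hp)
    · have t1 := hun p p' q ⟨h1, h3, hp, h5⟩
      have t2 := hun p p' q' ⟨h1, h3.trans h2, hp, h7⟩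
      exact h2.ne (t1.2.2.trans t2.2.2.symm)
  intro p p' q q' hpp hqq a1 a2 a3 a4 b1 b2 b3 b4
  rcases lt_or_gt_of_ne hpp with hp | hp <;> rcases lt_or_gt_of_ne hqq with hq | hq
  · exact ordered p p' q q' hp hq a3 b1 b2 b3 b4
  · exact ordered p p' q' q hp hq a4 b3 b4 b1 b2
  · exact ordered p' p q q' hp hq a1 b2 b1 b4 b3
  · exact ordered p' p q' q hp hq a2 b4 b3 b2 b1

theorem nc_inv {n : ℕ} {w : Equiv.Perm (Fin n)} (h : NC w) : NC w⁻¹ := by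
  intro p p' q q' hpp hqq a1 a2 a3 a4 b1 b2 b3 b4
  apply h (w⁻¹ q) (w⁻¹ q') (w⁻¹ p) (w⁻¹ p') (fun e => hqq (w⁻¹.injective e))
    (fun e => hpp (w⁻¹.injective e)) b1 b2 b3 b4
  all_goals rw [app_inv, app_inv]; assumption

theorem uniq_inv {n : ℕ} {w : Equiv.Perm (Fin n)} (h : Uniq w) : Uniq w⁻¹ := by
  obtain ⟨a, b, c, ⟨h1, h2, h3, h4⟩, hun⟩ := h
  refine ⟨w c, w b, w a, ⟨h4, h3, ?_, ?_⟩, ?_⟩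
  · rwa [inv_app, inv_app]
  · rwa [inv_app, inv_app]
  · rintro a' b' c' ⟨d1, d2, d3, d4⟩
    obtain ⟨e1, e2, e3⟩ := hun (w⁻¹ c') (w⁻¹ b') (w⁻¹ a')
      ⟨d4, d3, by rwa [app_inv, app_inv], by rwa [app_inv, app_inv]⟩
    rw [← e1, ← e2, ← e3, app_inv, app_inv, app_inv]
    exact ⟨rfl, rfl, rfl⟩

section step
variable {n k : ℕ} {x : Equiv.Perm (Fin n)}

theorem nc_step (h1 : 1 ≤ k) (h2 : k < n) (hx : Pres k x) (h : NC (sA n k * x)) : NC x := by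
  intro p p' q q' hpp hqq a1 a2 a3 a4 b1 b2 b3 b4
  have s1 := sA_val h1 h2 (x p)
  have s2 := sA_val h1 h2 (x p')
  have s3 := sA_val h1 h2 (x q)
  have s4 := sA_val h1 h2 (x q')
  have t1 := hx p
  have t2 := hx p'
  have t3 := hx q
  have t4 := hx q'
  apply h p p' q q' hpp hqq a1 a2 a3 a4
  all_goals
    rw [Equiv.Perm.mul_apply, Equiv.Perm.mul_apply]
    rw [Fin.lt_def] at *
    omega

theorem dec3_step (h1 : 1 ≤ k) (h2 : k < n) (hx : Pres k x) (a b c : Fin n) :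
    Dec3 (sA n k * x) a b c ↔ Dec3 x a b c := by
  have s1 := sA_val h1 h2 (x a)
  have s2 := sA_val h1 h2 (x b)
  have s3 := sA_val h1 h2 (x c)
  have t1 := hx a
  have t2 := hx b
  have t3 := hx c
  have i1 : a.val ≠ b.val → (x a).val ≠ (x b).val := fun h e =>
    h (congrArg Fin.val (x.injective (Fin.ext e)))
  have i2 : a.val ≠ c.val → (x a).val ≠ (x c).val := fun h e =>
    h (congrArg Fin.val (x.injective (Fin.ext e)))
  have i3 : b.val ≠ c.val → (x b).val ≠ (x c).val := fun h e =>
    h (congrArg Fin.val (x.injective (Fin.ext e)))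
  unfold Dec3
  simp only [Equiv.Perm.mul_apply, Fin.lt_def]
  constructor
  · rintro ⟨u1, u2, u3, u4⟩
    refine ⟨u1, u2, ?_, ?_⟩ <;> omega
  · rintro ⟨u1, u2, u3, u4⟩
    refine ⟨u1, u2, ?_, ?_⟩ <;> omega

theorem uniq_step (h1 : 1 ≤ k) (h2 : k < n) (hx : Pres k x) (h : Uniq (sA n k * x)) : Uniq x := by
  obtain ⟨a, b, c, hd, hun⟩ := h
  refine ⟨a, b, c, (dec3_step h1 h2 hx a b c).1 hd, ?_⟩
  intro a' b' c' hd'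
  exact hun a' b' c' ((dec3_step h1 h2 hx a' b' c').2 hd')

end step

/-- `k` splits off from `w` on the left. -/
def LGood {n : ℕ} (w : Equiv.Perm (Fin n)) : Prop :=
  ∃ k, 1 ≤ k ∧ k < n ∧ Pres k (sA n k * w)

theorem lgood_min {n : ℕ} {w : Equiv.Perm (Fin n)} {i : Fin n}
    (hfix : ∀ j, j < i → w j = j) (h : (w i).val = i.val + 1) : LGood w := by
  have hn : i.val + 1 < n := by have := (w i).2; omega
  refine ⟨i.val + 1, by omega, hn, ?_⟩
  intro p
  rw [Equiv.Perm.mul_apply]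
  have s := sA_val (by omega : 1 ≤ i.val + 1) hn (w p)
  have f1 : p.val < i.val → (w p).val = p.val := fun hp => congrArg Fin.val (hfix p hp)
  have f2 : (w p).val < i.val → (w p).val = p.val := fun hp =>
    congrArg Fin.val (w.injective (hfix (w p) hp))
  have f3 : p.val = i.val → (w p).val = i.val + 1 := fun hp => by rw [Fin.ext hp]; exact h
  have f4 : (w p).val = i.val + 1 → p.val = i.val := fun hp =>
    congrArg Fin.val (w.injective (Fin.ext (hp.trans h.symm)))
  omega

theorem lgood_max {n : ℕ} {w : Equiv.Perm (Fin n)} {m : Fin n}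
    (hfix : ∀ j, m < j → w j = j) (h : (w m).val + 1 = m.val) : LGood w := by
  refine ⟨m.val, by omega, m.2, ?_⟩
  intro p
  rw [Equiv.Perm.mul_apply]
  have s := sA_val (by omega : 1 ≤ m.val) m.2 (w p)
  have f1 : m.val < p.val → (w p).val = p.val := fun hp => congrArg Fin.val (hfix p hp)
  have f2 : m.val < (w p).val → (w p).val = p.val := fun hp =>
    congrArg Fin.val (w.injective (hfix (w p) hp))
  have f3 : p.val = m.val → (w p).val + 1 = m.val := fun hp => by rw [Fin.ext hp]; exact h
  have f4 : (w p).val + 1 = m.val → p.val = m.val := fun hp =>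
    congrArg Fin.val (w.injective (Fin.ext (by omega : (w p).val = (w m).val)))
  omega

theorem inv_fix {n : ℕ} {w : Equiv.Perm (Fin n)} {j : Fin n} (h : w j = j) : w⁻¹ j = j := by
  conv_lhs => rw [← h]
  exact inv_app w j

theorem classify {n : ℕ} {w : Equiv.Perm (Fin n)} (hnc : NC w) (hu : Uniq w) :
    LGood w ∨ LGood w⁻¹ ∨ ∃ k, 1 ≤ k ∧ k + 1 < n ∧
      ∀ p : Fin n, (p.val = k - 1 ∧ (w p).val = k + 1) ∨ (p.val = k ∧ (w p).val = k) ∨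
      (p.val = k + 1 ∧ (w p).val = k - 1) ∨
      ((p.val < k - 1 ∨ k + 1 < p.val) ∧ (w p).val = p.val) := by
  obtain ⟨a, b, c, ⟨d1, d2, d3, d4⟩, hun⟩ := hu
  have hne : {i : Fin n | w i ≠ i}.Nonempty := by
    by_contra hc
    rw [Set.not_nonempty_iff_eq_empty, Set.eq_empty_iff_forall_notMem] at hc
    have e1 : w a = a := by by_contra h; exact hc a h
    have e2 : w b = b := by by_contra h; exact hc b h
    rw [e1, e2] at d3
    exact lt_asymm d1 d3
  obtain ⟨i, hi, himin⟩ := WellFounded.has_min (r := ((· < ·) : Fin n → Fin n → Prop))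
    wellFounded_lt _ hne
  obtain ⟨m, hm, hmmax⟩ := WellFounded.has_min (r := ((· > ·) : Fin n → Fin n → Prop))
    wellFounded_gt _ hne
  have hfi : ∀ j, j < i → w j = j := by
    intro j hj; by_contra h; exact himin j h hj
  have hfm : ∀ j, m < j → w j = j := by
    intro j hj; by_contra h; exact hmmax j h hj
  have hfi' : ∀ j, j < i → w⁻¹ j = j := fun j hj => inv_fix (hfi j hj)
  have hfm' : ∀ j, m < j → w⁻¹ j = j := fun j hj => inv_fix (hfm j hj)
  by_cases hA : (w i).val = i.val + 1
  · exact Or.inl (lgood_min hfi hA)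
  by_cases hB : (w⁻¹ i).val = i.val + 1
  · exact Or.inr (Or.inl (lgood_min hfi' hB))
  by_cases hC : (w m).val + 1 = m.val
  · exact Or.inl (lgood_max hfm hC)
  by_cases hD : (w⁻¹ m).val + 1 = m.val
  · exact Or.inr (Or.inl (lgood_max hfm' hD))
  right; right
  -- basic facts
  have inj : ∀ p q : Fin n, (w p).val = (w q).val → p.val = q.val := fun p q h =>
    congrArg Fin.val (w.injective (Fin.ext h))
  have lowv : ∀ p : Fin n, p.val < i.val → (w p).val = p.val := fun p hp =>
    congrArg Fin.val (hfi p hp)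
  have loww : ∀ p : Fin n, (w p).val < i.val → (w p).val = p.val := fun p hp =>
    congrArg Fin.val (w.injective (hfi (w p) hp))
  have highv : ∀ p : Fin n, m.val < p.val → (w p).val = p.val := fun p hp =>
    congrArg Fin.val (hfm p hp)
  have highw : ∀ p : Fin n, m.val < (w p).val → (w p).val = p.val := fun p hp =>
    congrArg Fin.val (w.injective (hfm (w p) hp))
  have hi' : (w i).val ≠ i.val := fun h => hi (Fin.ext h)
  have hm' : (w m).val ≠ m.val := fun h => hm (Fin.ext h)
  obtain ⟨q, hq⟩ : ∃ q, w q = i := ⟨w⁻¹ i, app_inv w i⟩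
  obtain ⟨r, hr⟩ : ∃ r, w r = m := ⟨w⁻¹ m, app_inv w m⟩
  have hqi : w⁻¹ i = q := by rw [← hq, inv_app]
  have hrm : w⁻¹ m = r := by rw [← hr, inv_app]
  rw [hqi] at hB
  rw [hrm] at hD
  have hqv : (w q).val = i.val := congrArg Fin.val hq
  have hrv : (w r).val = m.val := congrArg Fin.val hr
  have wi : i.val + 1 < (w i).val := by
    have := loww i
    omega
  have qi : i.val + 1 < q.val := by
    have h1 := lowv q
    have h2 : q.val ≠ i.val := fun h => by
      rw [Fin.ext h] at hqv; exact hi' hqv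
    omega
  have wm : (w m).val + 1 < m.val := by
    have := highw m
    omega
  have rm : r.val + 1 < m.val := by
    have h1 := highv r
    have h2 : r.val ≠ m.val := fun h => by
      rw [Fin.ext h] at hrv; exact hm' hrv
    omega
  obtain ⟨b1, hb1⟩ : ∃ b1 : Fin n, b1.val = i.val + 1 :=
    ⟨⟨i.val + 1, by have := q.2; omega⟩, rfl⟩
  obtain ⟨b2, hb2⟩ : ∃ b2 : Fin n, b2.val + 1 = m.val :=
    ⟨⟨m.val - 1, by have := m.2; omega⟩, by simp; omega⟩
  have wb1 : (w b1).val = b1.val := by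
    by_contra hne1
    obtain ⟨q', hq'⟩ : ∃ q, w q = b1 := ⟨w⁻¹ b1, app_inv w b1⟩
    have hq'v : (w q').val = b1.val := congrArg Fin.val hq'
    have e1 := loww b1
    have e2 := inj b1 q
    have e3 := lowv q'
    have e4 : q'.val ≠ i.val := fun h => by
      rw [Fin.ext h] at hq'v; omega
    have e5 : q'.val ≠ b1.val := fun h => by
      rw [Fin.ext h] at hq'v; omega
    have e6 : q.val ≠ q'.val := fun h => by
      rw [Fin.ext h] at hqv; omega
    refine hnc i b1 q q' ?_ ?_ ?_ ?_ ?_ ?_ ?_ ?_ ?_ ?_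
    · intro h; have := congrArg Fin.val h; omega
    · intro h; exact e6 (congrArg Fin.val h)
    all_goals (rw [Fin.lt_def]; omega)
  have wb2 : (w b2).val = b2.val := by
    by_contra hne1
    obtain ⟨r', hr'⟩ : ∃ q, w q = b2 := ⟨w⁻¹ b2, app_inv w b2⟩
    have hr'v : (w r').val = b2.val := congrArg Fin.val hr'
    have e1 := highw b2
    have e2 := inj b2 r
    have e3 := highv r'
    have e4 : r'.val ≠ m.val := fun h => by
      rw [Fin.ext h] at hr'v; omega
    have e5 : r'.val ≠ b2.val := fun h => by
      rw [Fin.ext h] at hr'v; omega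
    have e6 : r.val ≠ r'.val := fun h => by
      rw [Fin.ext h] at hrv; omega
    refine hnc r r' b2 m ?_ ?_ ?_ ?_ ?_ ?_ ?_ ?_ ?_ ?_
    · intro h; exact e6 (congrArg Fin.val h)
    · intro h; have := congrArg Fin.val h; omega
    all_goals (rw [Fin.lt_def]; omega)
  have t1 := hun i b1 q ⟨by rw [Fin.lt_def]; omega, by rw [Fin.lt_def]; omega,
    by rw [Fin.lt_def]; omega, by rw [Fin.lt_def]; omega⟩
  have t2 := hun r b2 m ⟨by rw [Fin.lt_def]; omega, by rw [Fin.lt_def]; omega,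
    by rw [Fin.lt_def]; omega, by rw [Fin.lt_def]; omega⟩
  have u1 : i = r := t1.1.trans t2.1.symm
  have u2 : b1 = b2 := t1.2.1.trans t2.2.1.symm
  have u3 : q = m := t1.2.2.trans t2.2.2.symm
  subst u1 u2 u3
  refine ⟨i.val + 1, by omega, by have := q.2; omega, ?_⟩
  intro p
  have l1 := lowv p
  have l2 := highv p
  have l3 : p.val = i.val → (w p).val = q.val := fun h => by rw [Fin.ext h]; exact hrv
  have l4 : p.val = b1.val → (w p).val = b1.val := fun h => by rw [Fin.ext h]; exact wb1
  have l5 : p.val = q.val → (w p).val = i.val := fun h => by rw [Fin.ext h]; exact hqv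
  omega

theorem main_aux {n : ℕ} (L : ℕ) : ∀ w : Equiv.Perm (Fin n), lenA n w = L → NC w → Uniq w →
    Nat.card {v : Equiv.Perm (Fin n) // bruhatA n v w} = 3 * 2 ^ (L - 2) ∧ 2 ≤ L := by
  induction L with
  | zero =>
    intro w hL hnc hu
    exfalso
    rcases classify hnc hu with ⟨k, h1, h2, hp⟩ | ⟨k, h1, h2, hp⟩ | ⟨k, h1, h2, hw⟩
    · have := len_step h1 h2 hp
      rw [sA_cancel] at this
      omega
    · have := len_step h1 h2 hp
      rw [sA_cancel, len_inv] at this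
      omega
    · have := (base h1 h2 hw).2
      omega
  | succ L ih =>
    have left : ∀ w : Equiv.Perm (Fin n), lenA n w = L + 1 → NC w → Uniq w → LGood w →
        Nat.card {v : Equiv.Perm (Fin n) // bruhatA n v w} = 3 * 2 ^ (L + 1 - 2) ∧ 2 ≤ L + 1 := by
      rintro w hL hnc hu ⟨k, h1, h2, hp⟩
      have hl := len_step h1 h2 hp
      have hc := card_step h1 h2 hp
      have hnc' := nc_step h1 h2 hp (by rw [sA_cancel]; exact hnc)
      have hu' := uniq_step h1 h2 hp (by rw [sA_cancel]; exact hu)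
      rw [sA_cancel] at hl hc
      obtain ⟨i1, i2⟩ := ih (sA n k * w) (by omega) hnc' hu'
      refine ⟨?_, by omega⟩
      rw [hc, i1]
      obtain ⟨t, rfl⟩ := Nat.exists_eq_add_of_le i2
      have x1 : 2 + t - 2 = t := by omega
      have x2 : 2 + t + 1 - 2 = t + 1 := by omega
      rw [x1, x2, pow_succ]
      ring
    intro w hL hnc hu
    rcases classify hnc hu with h | h | ⟨k, h1, h2, hw⟩
    · exact left w hL hnc hu h
    · have := left w⁻¹ (by rw [len_inv, hL]) (nc_inv hnc) (uniq_inv hu) h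
      rwa [card_inv] at this
    · obtain ⟨c1, c2⟩ := base h1 h2 hw
      have : L = 2 := by omega
      subst this
      exact ⟨by rw [c1]; rfl, by omega⟩

theorem stmt4 (n : ℕ) (w : Equiv.Perm (Fin n))
    (h3412 : AvoidsA w p3412)
    (h321 : ∃! t : Fin n × Fin n × Fin n,
      t.1 < t.2.1 ∧ t.2.1 < t.2.2 ∧ w t.2.1 < w t.1 ∧ w t.2.2 < w t.2.1) :
    Nat.card {v : Equiv.Perm (Fin n) // bruhatA n v w} = 3 * 2 ^ (lenA n w - 2) := by
  have hu : Uniq w := by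
    obtain ⟨⟨a, b, c⟩, hd, hun⟩ := h321
    refine ⟨a, b, c, hd, ?_⟩
    intro a' b' c' hd'
    have := hun (a', b', c') hd'
    simpa using this
  exact (main_aux (lenA n w) w rfl (nc_of h3412 hu) hu).1

end Paper
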